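/- arXiv:2602.20941 — 2 statements merged into one kernel-verified Lean document; each statement's English description precedes it below -/
import Mathlib

section
/- For all λ, t ∈ [0,1] with (λ,t) ≠ (1,0) and all 4×4 complex Hermitian matrices B⁺, B⁻ with 0 ⪯ B⁺ ⪯ I₄ and 0 ⪯ B⁻ ⪯ I₄, one has tr(B⁺·Π_x⁺) + tr(B⁻·Π_x⁻) ≤ s_c(λ,t). -/
open Matrix Kronecker ComplexOrder

noncomputable section

/-- Pauli matrices. -/
def pauliX : Matrix (Fin 2) (Fin 2) ℂ := !![0, 1; 1, 0]
def pauliY : Matrix (Fin 2) (Fin 2) ℂ := !![0, -Complex.I; Complex.I, 0]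
def pauliZ : Matrix (Fin 2) (Fin 2) ℂ := !![1, 0; 0, -1]

/-- `Λ = (1-λ)(1+3λ)`. -/
def Lambda (lam : ℝ) : ℝ := (1 - lam) * (1 + 3 * lam)

/-- `R = √(Λ + 4t²λ²)`. -/
def Rr (lam t : ℝ) : ℝ := Real.sqrt (Lambda lam + 4 * t ^ 2 * lam ^ 2)

/-- `s_a(λ,t) = (1/2)(1 - λ + R)`. -/
def sA (lam t : ℝ) : ℝ := (1 / 2) * (1 - lam + Rr lam t)

/-- `s_c(λ,t) = (1/2)(1 - λ + √Λ)√(1-t²)`. -/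
def sC (lam t : ℝ) : ℝ :=
  (1 / 2) * (1 - lam + Real.sqrt (Lambda lam)) * Real.sqrt (1 - t ^ 2)

/-- The 4×4 Hermitian matrix `Π_z^ε` (`ε = ±1`), with diagonal
`(1/4)(−(1−εt)(1−λ), (1+εt)(1−λ), εt(1+λ), εt(1+λ))`, entries `(3,4)` and `(4,3)` equal to
`−R/4`, and all other entries `0`.  The index `Fin 2 × Fin 2` is ordered
`(0,0),(0,1),(1,0),(1,1)`. -/
def Piz (lam t ε : ℝ) : Matrix (Fin 2 × Fin 2) (Fin 2 × Fin 2) ℂ :=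
  (!![1, 0; 0, 0] : Matrix (Fin 2) (Fin 2) ℂ) ⊗ₖ
    !![((-(1 - ε * t) * (1 - lam) / 4 : ℝ) : ℂ), 0;
       0, (((1 + ε * t) * (1 - lam) / 4 : ℝ) : ℂ)] +
  (!![0, 0; 0, 1] : Matrix (Fin 2) (Fin 2) ℂ) ⊗ₖ
    !![((ε * t * (1 + lam) / 4 : ℝ) : ℂ), ((-(Rr lam t) / 4 : ℝ) : ℂ);
       ((-(Rr lam t) / 4 : ℝ) : ℂ), ((ε * t * (1 + lam) / 4 : ℝ) : ℂ)]

/-- `T_pp = √((1+λ+2λ√(1−t²))(1+√((1−t²)Λ)/R))`. -/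
def Tpp (lam t : ℝ) : ℝ :=
  Real.sqrt ((1 + lam + 2 * lam * Real.sqrt (1 - t ^ 2)) *
    (1 + Real.sqrt ((1 - t ^ 2) * Lambda lam) / Rr lam t))

/-- `T_pm = √((1+λ+2λ√(1−t²))(1−√((1−t²)Λ)/R))`. -/
def Tpm (lam t : ℝ) : ℝ :=
  Real.sqrt ((1 + lam + 2 * lam * Real.sqrt (1 - t ^ 2)) *
    (1 - Real.sqrt ((1 - t ^ 2) * Lambda lam) / Rr lam t))

/-- `T_mp = √((1+λ−2λ√(1−t²))(1+√((1−t²)Λ)/R))`. -/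
def Tmp (lam t : ℝ) : ℝ :=
  Real.sqrt ((1 + lam - 2 * lam * Real.sqrt (1 - t ^ 2)) *
    (1 + Real.sqrt ((1 - t ^ 2) * Lambda lam) / Rr lam t))

/-- `T_mm = √((1+λ−2λ√(1−t²))(1−√((1−t²)Λ)/R))`. -/
def Tmm (lam t : ℝ) : ℝ :=
  Real.sqrt ((1 + lam - 2 * lam * Real.sqrt (1 - t ^ 2)) *
    (1 - Real.sqrt ((1 - t ^ 2) * Lambda lam) / Rr lam t))

/-- The 2×2 matrix `E_ε` (`ε = ±1`). -/
def Emat (lam t ε : ℝ) : Matrix (Fin 2) (Fin 2) ℂ :=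
  !![((-Real.sqrt (1 - ε * t) * (Tmp lam t + ε * Tpm lam t) : ℝ) : ℂ),
     ((Real.sqrt (1 - ε * t) * (Tpp lam t + ε * Tmm lam t) : ℝ) : ℂ);
     ((Real.sqrt (1 + ε * t) * (Tmp lam t - ε * Tpm lam t) : ℝ) : ℂ),
     ((Real.sqrt (1 + ε * t) * (Tpp lam t - ε * Tmm lam t) : ℝ) : ℂ)]

/-- The 2×2 matrix `F_ε` (`ε = ±1`). -/
def Fmat (lam t ε : ℝ) : Matrix (Fin 2) (Fin 2) ℂ :=
  !![-Complex.I * ((Real.sqrt (1 - ε * t) * (Tmp lam t + ε * Tpm lam t) : ℝ) : ℂ),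
     Complex.I * ((Real.sqrt (1 - ε * t) * (Tpp lam t + ε * Tmm lam t) : ℝ) : ℂ);
     -Complex.I * ((Real.sqrt (1 + ε * t) * (Tmp lam t - ε * Tpm lam t) : ℝ) : ℂ),
     -Complex.I * ((Real.sqrt (1 + ε * t) * (Tpp lam t - ε * Tmm lam t) : ℝ) : ℂ)]

/-- `Π_x^ε = (√(1−λ)/8) [[0, E_ε], [E_ε^*, 0]]` in 2×2 block form. -/
def Pix (lam t ε : ℝ) : Matrix (Fin 2 × Fin 2) (Fin 2 × Fin 2) ℂ :=
  ((Real.sqrt (1 - lam) / 8 : ℝ) : ℂ) •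
    ((!![0, 1; 0, 0] : Matrix (Fin 2) (Fin 2) ℂ) ⊗ₖ Emat lam t ε +
     (!![0, 0; 1, 0] : Matrix (Fin 2) (Fin 2) ℂ) ⊗ₖ (Emat lam t ε)ᴴ)

/-- `Π_y^ε = (√(1−λ)/8) [[0, F_ε], [F_ε^*, 0]]` in 2×2 block form. -/
def Piy (lam t ε : ℝ) : Matrix (Fin 2 × Fin 2) (Fin 2 × Fin 2) ℂ :=
  ((Real.sqrt (1 - lam) / 8 : ℝ) : ℂ) •
    ((!![0, 1; 0, 0] : Matrix (Fin 2) (Fin 2) ℂ) ⊗ₖ Fmat lam t ε +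
     (!![0, 0; 1, 0] : Matrix (Fin 2) (Fin 2) ℂ) ⊗ₖ (Fmat lam t ε)ᴴ)

end

lemma trace_psd_aux (A : Matrix (Fin 2 × Fin 2) (Fin 2 × Fin 2) ℂ) (hA : A.PosSemidef)
    (W : Matrix (Fin 2 × Fin 2) (Fin 2) ℂ) : 0 ≤ (A * (W * Wᴴ)).trace.re := by
  have h := (hA.conjTranspose_mul_mul_same W).trace_nonneg
  rw [← Matrix.mul_assoc, Matrix.trace_mul_comm, ← Matrix.mul_assoc]
  exact (Complex.le_def.1 h).1

/-- Off-diagonal block matrix built from a `2 × 2` matrix. -/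
def blockOff (E : Matrix (Fin 2) (Fin 2) ℂ) : Matrix (Fin 2 × Fin 2) (Fin 2 × Fin 2) ℂ :=
  (!![0, 1; 0, 0] : Matrix (Fin 2) (Fin 2) ℂ) ⊗ₖ E +
     (!![0, 0; 1, 0] : Matrix (Fin 2) (Fin 2) ℂ) ⊗ₖ Eᴴ

/-- The (scaled) isometry used in the explicit polar decomposition. -/
def polarV (p q r s n σ : ℝ) : Matrix (Fin 2 × Fin 2) (Fin 2) ℂ :=
  fun ij k => if ij.1 = 0 then
    (!![((σ * (p - s) : ℝ) : ℂ), ((σ * (q + r) : ℝ) : ℂ);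
       ((σ * (q + r) : ℝ) : ℂ), ((σ * (s - p) : ℝ) : ℂ)] : Matrix (Fin 2) (Fin 2) ℂ) ij.2 k
    else ((n : ℂ) • (1 : Matrix (Fin 2) (Fin 2) ℂ)) ij.2 k

/-- Real matrix viewed as complex matrix. -/
def realE (p q r s : ℝ) : Matrix (Fin 2) (Fin 2) ℂ := !![(p : ℂ), (q : ℂ); (r : ℂ), (s : ℂ)]

/-- Scaled positive part. -/
def polarP (p q r s n σ : ℝ) : Matrix (Fin 2 × Fin 2) (Fin 2 × Fin 2) ℂ :=
  (polarV p q r s n σ * (realE p q r s)ᴴ) * (polarV p q r s n σ * (realE p q r s)ᴴ)ᴴ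
    + ((q * r - p * s : ℝ) : ℂ) • (polarV p q r s n σ * (polarV p q r s n σ)ᴴ)

lemma polarP_sub (p q r s n : ℝ)
    (hn : n ^ 2 = p ^ 2 + q ^ 2 + r ^ 2 + s ^ 2 - 2 * (p * s - q * r)) :
    polarP p q r s n 1 - polarP p q r s n (-1)
      = ((2 * n ^ 3 : ℝ) : ℂ) • blockOff (realE p q r s) := by
  have hc : (n : ℂ) ^ 2 = p ^ 2 + q ^ 2 + r ^ 2 + s ^ 2 - 2 * (p * s - q * r) := by
    exact_mod_cast hn
  ext ⟨i, j⟩ ⟨k, l⟩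
  fin_cases i <;> fin_cases j <;> fin_cases k <;> fin_cases l <;>
    simp [polarP, polarV, realE, blockOff, Matrix.mul_apply, Fin.sum_univ_two, Matrix.one_apply,
      Matrix.vecMul, dotProduct]
  all_goals first
    | ring1
    | linear_combination (-2 * (n : ℂ) * p) * hc
    | linear_combination (-2 * (n : ℂ) * q) * hc
    | linear_combination (-2 * (n : ℂ) * r) * hc
    | linear_combination (-2 * (n : ℂ) * s) * hc

lemma polarP_trace (p q r s n : ℝ)
    (hn : n ^ 2 = p ^ 2 + q ^ 2 + r ^ 2 + s ^ 2 - 2 * (p * s - q * r)) :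
    (polarP p q r s n 1).trace = ((2 * n ^ 4 : ℝ) : ℂ) := by
  have hc : (n : ℂ) ^ 2 = p ^ 2 + q ^ 2 + r ^ 2 + s ^ 2 - 2 * (p * s - q * r) := by
    exact_mod_cast hn
  simp [Matrix.trace, Fintype.sum_prod_type, polarP, polarV, realE, Matrix.mul_apply,
    Fin.sum_univ_two, Matrix.one_apply,
      Matrix.vecMul, dotProduct]
  linear_combination (-2 * (n : ℂ) ^ 2 -
    (p ^ 2 + q ^ 2 + r ^ 2 + s ^ 2 - 2 * (p * s - q * r))) * hc

lemma polarP_pos (p q r s n σ : ℝ) (hd : p * s - q * r ≤ 0)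
    (A : Matrix (Fin 2 × Fin 2) (Fin 2 × Fin 2) ℂ) (hA : A.PosSemidef) :
    0 ≤ (A * polarP p q r s n σ).trace.re := by
  have h1 := trace_psd_aux A hA (polarV p q r s n σ * (realE p q r s)ᴴ)
  have h2 := trace_psd_aux A hA (polarV p q r s n σ)
  rw [polarP, Matrix.mul_add, Matrix.trace_add, Matrix.mul_smul, Matrix.trace_smul,
    Complex.add_re, smul_eq_mul, Complex.re_ofReal_mul]
  have : 0 ≤ q * r - p * s := by linarith
  positivity

lemma trace_block_le (p q r s n : ℝ) (hd : p * s - q * r ≤ 0) (hn0 : 0 ≤ n)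
    (hn : n ^ 2 = p ^ 2 + q ^ 2 + r ^ 2 + s ^ 2 - 2 * (p * s - q * r))
    (B : Matrix (Fin 2 × Fin 2) (Fin 2 × Fin 2) ℂ) (hB0 : B.PosSemidef)
    (hB1 : (1 - B).PosSemidef) :
    (B * blockOff (realE p q r s)).trace.re ≤ n := by
  rcases hn0.eq_or_lt with h0 | hpos
  · subst h0
    have hp : p = 0 := by nlinarith [sq_nonneg p, sq_nonneg q, sq_nonneg r, sq_nonneg s]
    have hq : q = 0 := by nlinarith [sq_nonneg p, sq_nonneg q, sq_nonneg r, sq_nonneg s]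
    have hr : r = 0 := by nlinarith [sq_nonneg p, sq_nonneg q, sq_nonneg r, sq_nonneg s]
    have hs : s = 0 := by nlinarith [sq_nonneg p, sq_nonneg q, sq_nonneg r, sq_nonneg s]
    have hz : blockOff (realE p q r s) = 0 := by
      subst hp hq hr hs
      ext ⟨i, j⟩ ⟨k, l⟩
      fin_cases i <;> fin_cases j <;> fin_cases k <;> fin_cases l <;> simp [blockOff, realE]
    simp [hz]
  · have h1 := polarP_pos p q r s n 1 hd _ hB1
    have h2 := polarP_pos p q r s n (-1) hd _ hB0
    have h3 := congrArg (fun M => (B * M).trace.re) (polarP_sub p q r s n hn)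
    simp only [Matrix.mul_sub, Matrix.trace_sub, Complex.sub_re, Matrix.mul_smul,
      Matrix.trace_smul, smul_eq_mul, Complex.re_ofReal_mul] at h3
    rw [Matrix.sub_mul, Matrix.trace_sub, Complex.sub_re, Matrix.one_mul,
      polarP_trace p q r s n hn, Complex.ofReal_re] at h1
    have h4 : 2 * n ^ 3 * (B * blockOff (realE p q r s)).trace.re ≤ 2 * n ^ 3 * n := by
      nlinarith
    exact le_of_mul_le_mul_left h4 (by positivity)

lemma T_facts (lam t : ℝ) (hl0 : 0 ≤ lam) (hl1 : lam < 1) (ht0 : 0 ≤ t) (ht1 : t ≤ 1) :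
    Tmp lam t ^ 2 + Tpm lam t ^ 2 + Tpp lam t ^ 2 + Tmm lam t ^ 2 = 4 * (1 + lam) ∧
    Tmp lam t * Tpm lam t = t * (1 + lam) ∧ Tpp lam t * Tmm lam t = t * (1 + lam) ∧
    Tmp lam t * Tpp lam t - Tpm lam t * Tmm lam t
      = 2 * (Real.sqrt (1 - t ^ 2) * Real.sqrt (Lambda lam)) := by
  have hL : 0 < Lambda lam := by unfold Lambda; nlinarith
  have hu2 : 0 ≤ 1 - t ^ 2 := by nlinarith
  have hR2 : Rr lam t ^ 2 = Lambda lam + 4 * t ^ 2 * lam ^ 2 := Real.sq_sqrt (by positivity)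
  have hR : 0 < Rr lam t := Real.sqrt_pos.2 (by positivity)
  unfold Tmp Tpm Tpp Tmm
  rw [Real.sqrt_mul hu2]
  have hu := Real.sq_sqrt hu2
  have hw := Real.sq_sqrt hL.le
  have hu0 := Real.sqrt_nonneg (1 - t ^ 2)
  have hw0 := Real.sqrt_nonneg (Lambda lam)
  generalize Rr lam t = R at *
  generalize Real.sqrt (1 - t ^ 2) = u at *
  generalize Real.sqrt (Lambda lam) = w at *
  have hLe : Lambda lam = (1 - lam) * (1 + 3 * lam) := rfl
  rw [hLe] at hL hR2 hw
  obtain ⟨x, hx⟩ : ∃ x, x = u * w / R := ⟨_, rfl⟩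
  have hxR : x * R = u * w := by rw [hx]; field_simp
  have hx0 : 0 ≤ x := by rw [hx]; positivity
  rw [← hx]
  have hx2 : (1 - x ^ 2) * R ^ 2 = (t * (1 + lam)) ^ 2 := by
    have : x ^ 2 * R ^ 2 = u ^ 2 * w ^ 2 := by rw [← mul_pow, hxR, mul_pow]
    rw [hu, hw] at this
    linear_combination hR2 - this
  have hx1 : x ≤ 1 := by
    by_contra hcon
    push Not at hcon
    have : 0 < (x ^ 2 - 1) * R ^ 2 := by
      apply mul_pos _ (by positivity)
      nlinarith
    nlinarith [sq_nonneg (t * (1 + lam))]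
  have ha : 0 ≤ 1 + lam + 2 * lam * u := by positivity
  have hab : (1 + lam + 2 * lam * u) * (1 + lam - 2 * lam * u) = R ^ 2 := by
    linear_combination (-4 * lam ^ 2) * hu - hR2
  have hb : 0 ≤ 1 + lam - 2 * lam * u := by
    have : u ≤ 1 := by nlinarith
    nlinarith
  have hc : 0 ≤ 1 + x := by linarith
  have hd : 0 ≤ 1 - x := by linarith
  have htl : 0 ≤ t * (1 + lam) := by positivity
  rw [Real.sq_sqrt (by positivity), Real.sq_sqrt (by positivity), Real.sq_sqrt (by positivity),
    Real.sq_sqrt (by positivity), ← Real.sqrt_mul (by positivity), ← Real.sqrt_mul (by positivity),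
    ← Real.sqrt_mul (by positivity), ← Real.sqrt_mul (by positivity)]
  refine ⟨by ring, ?_, ?_, ?_⟩
  · rw [← Real.sqrt_sq htl]
    congr 1
    linear_combination (1 - x ^ 2) * hab + hx2
  · rw [← Real.sqrt_sq htl]
    congr 1
    linear_combination (1 - x ^ 2) * hab + hx2
  · have e1 : (1 + lam - 2 * lam * u) * (1 + x) * ((1 + lam + 2 * lam * u) * (1 + x))
        = (R * (1 + x)) ^ 2 := by linear_combination (1 + x) ^ 2 * hab
    have e2 : (1 + lam + 2 * lam * u) * (1 - x) * ((1 + lam - 2 * lam * u) * (1 - x))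
        = (R * (1 - x)) ^ 2 := by linear_combination (1 - x) ^ 2 * hab
    rw [e1, e2, Real.sqrt_sq (by positivity), Real.sqrt_sq (by positivity)]
    linear_combination 2 * hxR

lemma Pix_bound (lam t ε : ℝ) (hε : ε = 1 ∨ ε = -1) (hl0 : 0 ≤ lam) (hl1 : lam < 1)
    (ht0 : 0 ≤ t) (ht1 : t ≤ 1) (B : Matrix (Fin 2 × Fin 2) (Fin 2 × Fin 2) ℂ)
    (hB0 : B.PosSemidef) (hB1 : (1 - B).PosSemidef) :
    (B * Pix lam t ε).trace.re ≤ Real.sqrt (1 - lam) / 8 *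
      (2 * Real.sqrt (1 - t ^ 2) * (Real.sqrt (1 - lam) + Real.sqrt (1 + 3 * lam))) := by
  obtain ⟨f1, f2, f3, f4⟩ := T_facts lam t hl0 hl1 ht0 ht1
  have hε2 : ε ^ 2 = 1 := by rcases hε with h | h <;> rw [h] <;> norm_num
  have hm : 0 ≤ 1 - ε * t := by rcases hε with h | h <;> rw [h] <;> linarith
  have hp : 0 ≤ 1 + ε * t := by rcases hε with h | h <;> rw [h] <;> linarith
  have hP : Pix lam t ε = ((Real.sqrt (1 - lam) / 8 : ℝ) : ℂ) • blockOff (Emat lam t ε) := rfl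
  rw [hP, Matrix.mul_smul, Matrix.trace_smul, smul_eq_mul, Complex.re_ofReal_mul]
  apply mul_le_mul_of_nonneg_left _ (by positivity)
  have hml : Real.sqrt (1 - ε * t) * Real.sqrt (1 + ε * t) = Real.sqrt (1 - t ^ 2) := by
    rw [← Real.sqrt_mul hm]
    congr 1
    linear_combination (-t ^ 2) * hε2
  have hLam : Real.sqrt (Lambda lam) = Real.sqrt (1 - lam) * Real.sqrt (1 + 3 * lam) :=
    Real.sqrt_mul (by linarith) _
  have hA := Real.sq_sqrt (show (0 : ℝ) ≤ 1 - lam by linarith)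
  have hC := Real.sq_sqrt (show (0 : ℝ) ≤ 1 + 3 * lam by linarith)
  have hms := Real.sq_sqrt hm
  have hps := Real.sq_sqrt hp
  rw [hLam] at f4
  have hA0 := Real.sqrt_nonneg (1 - lam)
  have hC0 := Real.sqrt_nonneg (1 + 3 * lam)
  have hU0 := Real.sqrt_nonneg (1 - t ^ 2)
  have hUs := Real.sq_sqrt (show (0 : ℝ) ≤ 1 - t ^ 2 by nlinarith)
  unfold Emat
  generalize Tmp lam t = a at *
  generalize Tpm lam t = b at *
  generalize Tpp lam t = c at *
  generalize Tmm lam t = d at *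
  generalize Real.sqrt (1 - ε * t) = m at *
  generalize Real.sqrt (1 + ε * t) = l at *
  generalize Real.sqrt (1 - t ^ 2) = u at *
  generalize Real.sqrt (1 - lam) = A at *
  generalize Real.sqrt (1 + 3 * lam) = C at *
  have hdet : (-m * (a + ε * b)) * (l * (c - ε * d)) - (m * (c + ε * d)) * (l * (a - ε * b))
      = -4 * u ^ 2 * (A * C) := by
    have : (-m * (a + ε * b)) * (l * (c - ε * d)) - (m * (c + ε * d)) * (l * (a - ε * b))
      = (m * l) * (-2 * (a * c - ε ^ 2 * (b * d))) := by ring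
    rw [this, hml, hε2, one_mul, f4]
    ring
  have hF : (-m * (a + ε * b)) ^ 2 + (m * (c + ε * d)) ^ 2 + (l * (a - ε * b)) ^ 2
      + (l * (c - ε * d)) ^ 2 = 8 * (1 + lam) * u ^ 2 := by
    have : (-m * (a + ε * b)) ^ 2 + (m * (c + ε * d)) ^ 2 + (l * (a - ε * b)) ^ 2
      + (l * (c - ε * d)) ^ 2
      = m ^ 2 * (a ^ 2 + c ^ 2 + ε ^ 2 * (b ^ 2 + d ^ 2) + 2 * ε * (a * b + c * d))
        + l ^ 2 * (a ^ 2 + c ^ 2 + ε ^ 2 * (b ^ 2 + d ^ 2) - 2 * ε * (a * b + c * d)) := by ring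
    rw [this, hms, hps, hε2, f2, f3, hUs]
    linear_combination 2 * f1 - 8 * t ^ 2 * (1 + lam) * hε2
  refine trace_block_le _ _ _ _ _ ?_ (by positivity) ?_ B hB0 hB1
  · rw [hdet]
    have : 0 ≤ u ^ 2 * (A * C) := by positivity
    linarith
  · rw [hF, hdet]
    linear_combination 4 * u ^ 2 * (hA + hC)

/-- **Primal bound, complementary case.** For all `λ, t ∈ [0,1]` with `(λ,t) ≠ (1,0)` and
all effects `0 ⪯ B⁺, B⁻ ⪯ I₄`, one has `tr(B⁺ Π_x⁺) + tr(B⁻ Π_x⁻) ≤ s_c(λ,t)`. -/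
theorem complementary_primal_bound (lam t : ℝ)
    (hlam : lam ∈ Set.Icc (0 : ℝ) 1) (ht : t ∈ Set.Icc (0 : ℝ) 1)
    (hne : (lam, t) ≠ (1, 0))
    (Bp Bm : Matrix (Fin 2 × Fin 2) (Fin 2 × Fin 2) ℂ)
    (hBp0 : Bp.PosSemidef) (hBp1 : (1 - Bp).PosSemidef)
    (hBm0 : Bm.PosSemidef) (hBm1 : (1 - Bm).PosSemidef) :
    ((Bp * Pix lam t 1).trace + (Bm * Pix lam t (-1)).trace).re ≤ sC lam t := by
  obtain ⟨hl0, hl1⟩ := hlam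
  obtain ⟨ht0, ht1⟩ := ht
  rcases hl1.eq_or_lt with h | h
  · subst h
    have h0 : ∀ ε, Pix 1 t ε = 0 := fun ε => by simp [Pix]
    simp [h0, sC, Lambda]
  · have h1 := Pix_bound lam t 1 (Or.inl rfl) hl0 h ht0 ht1 Bp hBp0 hBp1
    have h2 := Pix_bound lam t (-1) (Or.inr rfl) hl0 h ht0 ht1 Bm hBm0 hBm1
    have hLam : Real.sqrt (Lambda lam) = Real.sqrt (1 - lam) * Real.sqrt (1 + 3 * lam) :=
      Real.sqrt_mul (by linarith) _
    have hA := Real.sq_sqrt (show (0 : ℝ) ≤ 1 - lam by linarith)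
    rw [Complex.add_re, sC, hLam]
    refine (add_le_add h1 h2).trans (le_of_eq ?_)
    linear_combination (1 / 2) * Real.sqrt (1 - t ^ 2) * hA
end

section
/- Let λ, t ∈ [0,1] with (λ,t) ≠ (1,0). Set b = √(1/2 + tλ/R), c = √(1/2 − tλ/R), B⁺ = (1/2)·(I₄ + c·σx⊗σx − b·σx⊗σz) and B⁻ = (1/2)·(I₄ + b·σx⊗σx − c·σx⊗σz). Then B⁺ and B⁻ are orthogonal projections of rank 2 (each is Hermitian, idempotent, of trace 2), and tr(B⁺·Π_x⁺) + tr(B⁻·Π_x⁻) = s_c(λ,t), tr(B⁺·Π_z⁺) + tr(B⁻·Π_z⁻) = 0, tr(B⁺·Π_y⁺) + tr(B⁻·Π_y⁻) = 0. -/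
open Matrix Kronecker ComplexOrder

noncomputable section
/-- `b = √(1/2 + tλ/R)`. -/
def bCoef (lam t : ℝ) : ℝ := Real.sqrt (1 / 2 + t * lam / Rr lam t)

/-- `c = √(1/2 − tλ/R)`. -/
def cCoef (lam t : ℝ) : ℝ := Real.sqrt (1 / 2 - t * lam / Rr lam t)

/-- `B⁺ = (1/2)(I₄ + c σx⊗σx − b σx⊗σz)`. -/
def BfeasP (lam t : ℝ) : Matrix (Fin 2 × Fin 2) (Fin 2 × Fin 2) ℂ :=
  (1 / 2 : ℂ) • ((1 : Matrix (Fin 2 × Fin 2) (Fin 2 × Fin 2) ℂ) +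
    ((cCoef lam t : ℝ) : ℂ) • (pauliX ⊗ₖ pauliX) -
    ((bCoef lam t : ℝ) : ℂ) • (pauliX ⊗ₖ pauliZ))

/-- `B⁻ = (1/2)(I₄ + b σx⊗σx − c σx⊗σz)`. -/
def BfeasM (lam t : ℝ) : Matrix (Fin 2 × Fin 2) (Fin 2 × Fin 2) ℂ :=
  (1 / 2 : ℂ) • ((1 : Matrix (Fin 2 × Fin 2) (Fin 2 × Fin 2) ℂ) +
    ((bCoef lam t : ℝ) : ℂ) • (pauliX ⊗ₖ pauliX) -
    ((cCoef lam t : ℝ) : ℂ) • (pauliX ⊗ₖ pauliZ))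
end

lemma core_identity (l t k n u v w b c p m P M : ℝ)
    (ht0 : 0 ≤ t)
    (hk : 0 < k) (hn : 0 < n) (hu : 0 ≤ u) (hv : 0 < v) (huv : u ≤ v)
    (hb : 0 ≤ b) (hc : 0 ≤ c) (hp : 0 ≤ p) (hm : 0 ≤ m) (hP : 0 < P) (hM : 0 < M)
    (hk2 : k ^ 2 = 1 - l) (hn2 : n ^ 2 = 1 + 3 * l) (hl : 0 ≤ l)
    (hu2 : u ^ 2 = 1 - t) (hv2 : v ^ 2 = 1 + t) (hw : w = u * v)
    (hP2 : P ^ 2 = 1 + l + 2 * l * w) (hM2 : M ^ 2 = 1 + l - 2 * l * w)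
    (hb2 : b ^ 2 = 1 / 2 + t * l / (P * M)) (hc2 : c ^ 2 = 1 / 2 - t * l / (P * M))
    (hp2 : p ^ 2 = 1 + w * (k * n) / (P * M)) (hm2 : m ^ 2 = 1 - w * (k * n) / (P * M)) :
    c * (u * (P * p + M * m) + v * (M * p - P * m)) +
      b * (u * (M * p + P * m) + v * (P * p - M * m)) = 2 * (k + n) * w := by
  have hw2 : w ^ 2 = 1 - t ^ 2 := by rw [hw, mul_pow, hu2, hv2]; ring
  have hR2 : P ^ 2 * M ^ 2 = k ^ 2 * n ^ 2 + 4 * t ^ 2 * l ^ 2 := by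
    rw [hP2, hM2, hk2, hn2]; linear_combination (-4 * l ^ 2) * hw2
  have hPn := hP.ne'
  have hMn := hM.ne'
  have hbc : b * c = k * n / (2 * (P * M)) := by
    rw [← sq_eq_sq₀ (by positivity) (by positivity), mul_pow, hb2, hc2]
    field_simp
    linear_combination hR2
  have hpm : p * m = t * (1 + l) / (P * M) := by
    rw [← sq_eq_sq₀ (by positivity) (by positivity), mul_pow, hp2, hm2]
    field_simp
    linear_combination hR2 - k ^ 2 * n ^ 2 * hw2 + t ^ 2 * n ^ 2 * hk2 + t ^ 2 * (1 - l) * hn2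
  set x := (u + v) / 2 with hx
  set y := (v - u) / 2 with hy
  have hx0 : 0 < x := by rw [hx]; linarith
  have hy0 : 0 ≤ y := by rw [hy]; linarith
  have hx2 : x ^ 2 = (1 + w) / 2 := by rw [hx]; linear_combination hu2 / 4 + hv2 / 4 - hw / 2
  have hy2 : y ^ 2 = (1 - w) / 2 := by rw [hy]; linear_combination hu2 / 4 + hv2 / 4 + hw / 2
  have hxy : x * y = t / 2 := by rw [hx, hy]; linear_combination hv2 / 4 - hu2 / 4
  have hue : u = x - y := by rw [hx, hy]; ring
  have hve : v = x + y := by rw [hx, hy]; ring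
  clear_value x y
  have e1 : c * p + b * m = (n * x + k * y) / P := by
    rw [← sq_eq_sq₀ (by positivity) (by positivity)]
    have : (c * p + b * m) ^ 2 = c ^ 2 * p ^ 2 + b ^ 2 * m ^ 2 + 2 * (b * c) * (p * m) := by ring
    have h2 : (n * x + k * y) ^ 2 = P ^ 2 + k * n * t := by
      have : (n * x + k * y) ^ 2 = n ^ 2 * x ^ 2 + k ^ 2 * y ^ 2 + 2 * k * n * (x * y) := by ring
      rw [this, hxy, hx2, hy2, hn2, hk2, hP2]; ring
    rw [this, hbc, hpm, hb2, hc2, hp2, hm2, div_pow, h2]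
    field_simp
    linear_combination (-2 * t * k * n) * hM2
  have e2 : b * p + c * m = (k * x + n * y) / M := by
    rw [← sq_eq_sq₀ (by positivity) (by positivity)]
    have : (b * p + c * m) ^ 2 = b ^ 2 * p ^ 2 + c ^ 2 * m ^ 2 + 2 * (b * c) * (p * m) := by ring
    have h2 : (k * x + n * y) ^ 2 = M ^ 2 + k * n * t := by
      have : (k * x + n * y) ^ 2 = k ^ 2 * x ^ 2 + n ^ 2 * y ^ 2 + 2 * k * n * (x * y) := by ring
      rw [this, hxy, hx2, hy2, hn2, hk2, hM2]; ring
    rw [this, hbc, hpm, hb2, hc2, hp2, hm2, div_pow, h2]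
    field_simp
    linear_combination (-2 * t * k * n) * hP2
  have e3 : b * p - c * m = (n * x - k * y) / P := by
    have hpos : (k * x + n * y) / M ≠ 0 := by positivity
    apply mul_left_cancel₀ hpos
    rw [← e2]
    have : (b * p + c * m) * (b * p - c * m) = b ^ 2 * p ^ 2 - c ^ 2 * m ^ 2 := by ring
    rw [this, e2, hb2, hc2, hp2, hm2]
    field_simp
    linear_combination (P * M) * (-2 * k * n * hx2 + 2 * k * n * hy2 - 2 * n ^ 2 * hxy
      + 2 * k ^ 2 * hxy - t * hn2 + t * hk2)
  have e4 : c * p - b * m = (k * x - n * y) / M := by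
    have hpos : (n * x + k * y) / P ≠ 0 := by positivity
    apply mul_left_cancel₀ hpos
    rw [← e1]
    have : (c * p + b * m) * (c * p - b * m) = c ^ 2 * p ^ 2 - b ^ 2 * m ^ 2 := by ring
    rw [this, e1, hb2, hc2, hp2, hm2]
    field_simp
    linear_combination (P * M) * (-2 * k * n * hx2 + 2 * k * n * hy2 + 2 * n ^ 2 * hxy
      - 2 * k ^ 2 * hxy + t * hn2 - t * hk2)
  have key : c * (u * (P * p + M * m) + v * (M * p - P * m)) +
      b * (u * (M * p + P * m) + v * (P * p - M * m)) =
      P * ((c * p + b * m) * u + (b * p - c * m) * v) +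
      M * ((b * p + c * m) * u + (c * p - b * m) * v) := by ring
  rw [key, e1, e2, e3, e4, hue, hve]
  field_simp
  linear_combination 2 * (n + k) * (hx2 - hy2)

lemma real_identity (l t : ℝ) (hl0 : 0 ≤ l) (hl1 : l ≤ 1) (ht0 : 0 ≤ t) (ht1 : t ≤ 1) :
    √(1 - l) * (cCoef l t * (√(1 - t) * (Tpp l t + Tmm l t) + √(1 + t) * (Tmp l t - Tpm l t)) +
      bCoef l t * (√(1 - t) * (Tmp l t + Tpm l t) + √(1 + t) * (Tpp l t - Tmm l t)))
      = 4 * sC l t := by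
  rcases hl1.eq_or_lt with rfl | hl1
  · simp [sC, Lambda]
  have hsw : √(1 - t ^ 2) = √(1 - t) * √(1 + t) := by
    rw [← Real.sqrt_mul (by linarith)]; congr 1; ring
  have hL : √(Lambda l) = √(1 - l) * √(1 + 3 * l) := by
    rw [Lambda, Real.sqrt_mul (by linarith)]
  have hw0 : 0 ≤ √(1 - t ^ 2) := Real.sqrt_nonneg _
  have hw1 : √(1 - t ^ 2) ≤ 1 := Real.sqrt_le_one.mpr (by nlinarith)
  have hwsq : √(1 - t ^ 2) ^ 2 = 1 - t ^ 2 := Real.sq_sqrt (by nlinarith)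
  have hwL : √((1 - t ^ 2) * Lambda l) = √(1 - t ^ 2) * (√(1 - l) * √(1 + 3 * l)) := by
    rw [Real.sqrt_mul (by nlinarith), hL]
  have hk2 : √(1 - l) ^ 2 = 1 - l := Real.sq_sqrt (by linarith)
  have hn2 : √(1 + 3 * l) ^ 2 = 1 + 3 * l := Real.sq_sqrt (by linarith)
  have hu2 : √(1 - t) ^ 2 = 1 - t := Real.sq_sqrt (by linarith)
  have hv2 : √(1 + t) ^ 2 = 1 + t := Real.sq_sqrt (by linarith)
  have huv : √(1 - t) ≤ √(1 + t) := Real.sqrt_le_sqrt (by linarith)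
  have hk : 0 < √(1 - l) := Real.sqrt_pos.mpr (by linarith)
  have hn : 0 < √(1 + 3 * l) := Real.sqrt_pos.mpr (by linarith)
  have hu : 0 ≤ √(1 - t) := Real.sqrt_nonneg _
  have hv : 0 < √(1 + t) := Real.sqrt_pos.mpr (by linarith)
  have hPa : 0 < 1 + l + 2 * l * √(1 - t ^ 2) := by positivity
  have hMa : 0 < 1 + l - 2 * l * √(1 - t ^ 2) := by nlinarith
  have hR : Rr l t = √(1 + l + 2 * l * √(1 - t ^ 2)) * √(1 + l - 2 * l * √(1 - t ^ 2)) := by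
    rw [← Real.sqrt_mul hPa.le, Rr, Lambda]
    congr 1
    linear_combination 4 * l ^ 2 * hwsq
  have hP := Real.sqrt_pos.mpr hPa
  have hM := Real.sqrt_pos.mpr hMa
  have hP2 := Real.sq_sqrt hPa.le
  have hM2 := Real.sq_sqrt hMa.le
  unfold cCoef bCoef Tpp Tmm Tmp Tpm sC
  rw [Real.sqrt_mul hPa.le, Real.sqrt_mul hPa.le, Real.sqrt_mul hMa.le, Real.sqrt_mul hMa.le,
    hL, hwL, hR]
  generalize √(1 + l + 2 * l * √(1 - t ^ 2)) = P at *
  generalize √(1 + l - 2 * l * √(1 - t ^ 2)) = M at *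
  generalize √(1 - t ^ 2) = w at *
  generalize √(1 - l) = k at *
  generalize √(1 + 3 * l) = n at *
  generalize √(1 - t) = u at *
  generalize √(1 + t) = v at *
  have hR2 : (P * M) ^ 2 = k ^ 2 * n ^ 2 + 4 * t ^ 2 * l ^ 2 := by
    rw [mul_pow, hP2, hM2, hk2, hn2]; linear_combination (-4 * l ^ 2) * hwsq
  have hPM : 0 < P * M := by positivity
  have h1 : t * l / (P * M) ≤ 1 / 2 := by
    rw [div_le_iff₀ hPM]
    have : 2 * (t * l) ≤ P * M := 
      (le_abs_self _).trans (abs_le_of_sq_le_sq (by nlinarith [sq_nonneg (k * n)]) hPM.le)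
    linarith
  have h2 : w * (k * n) / (P * M) ≤ 1 := by
    rw [div_le_one hPM]
    refine (le_abs_self _).trans (abs_le_of_sq_le_sq ?_ hPM.le)
    rw [hR2, mul_pow, hwsq, mul_pow]
    nlinarith [sq_nonneg (t * (k * n)), sq_nonneg (t * l)]
  have h10 : 0 ≤ t * l / (P * M) := by positivity
  have h20 : 0 ≤ w * (k * n) / (P * M) := by positivity
  have := core_identity l t k n u v w _ _ _ _ P M ht0 hk hn hu hv huv
    (Real.sqrt_nonneg _) (Real.sqrt_nonneg _) (Real.sqrt_nonneg _) (Real.sqrt_nonneg _)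
    hP hM hk2 hn2 hl0 hu2 hv2 hsw hP2 hM2
    (Real.sq_sqrt (by linarith : 0 ≤ 1 / 2 + t * l / (P * M)))
    (Real.sq_sqrt (by linarith : 0 ≤ 1 / 2 - t * l / (P * M)))
    (Real.sq_sqrt (by linarith : 0 ≤ 1 + w * (k * n) / (P * M)))
    (Real.sq_sqrt (by linarith : 0 ≤ 1 - w * (k * n) / (P * M)))
  rw [this]
  linear_combination 2 * w * hk2

lemma bc_sq (l t : ℝ) (hl0 : 0 ≤ l) (hl1 : l ≤ 1) (ht0 : 0 ≤ t) :
    bCoef l t ^ 2 + cCoef l t ^ 2 = 1 := by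
  have hLam : 0 ≤ Lambda l := mul_nonneg (by linarith) (by linarith)
  have h0 : 0 ≤ t * l / Rr l t := div_nonneg (by positivity) (Real.sqrt_nonneg _)
  have h1 : t * l / Rr l t ≤ 1 / 2 := by
    apply div_le_of_le_mul₀ (Real.sqrt_nonneg _) (by norm_num)
    have : 2 * (t * l) ≤ Rr l t := Real.le_sqrt_of_sq_le (by nlinarith)
    change t * l ≤ 1 / 2 * Rr l t
    linarith
  rw [bCoef, cCoef, Real.sq_sqrt (by linarith), Real.sq_sqrt (by linarith)]
  ring

lemma proj_aux (x y : ℝ) (h : x ^ 2 + y ^ 2 = 1) (B : Matrix (Fin 2 × Fin 2) (Fin 2 × Fin 2) ℂ)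
    (hB : B = (1 / 2 : ℂ) • ((1 : Matrix (Fin 2 × Fin 2) (Fin 2 × Fin 2) ℂ) +
    (x : ℂ) • (pauliX ⊗ₖ pauliX) - (y : ℂ) • (pauliX ⊗ₖ pauliZ))) :
    Bᴴ = B ∧ B * B = B ∧ B.trace = 2 := by
  have h' : (x : ℂ) ^ 2 + (y : ℂ) ^ 2 = 1 := by exact_mod_cast h
  subst hB
  refine ⟨?_, ?_, ?_⟩
  · ext ⟨i, j⟩ ⟨i', j'⟩
    fin_cases i <;> fin_cases j <;> fin_cases i' <;> fin_cases j' <;>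
      simp [pauliX, pauliZ, Matrix.one_apply]
  · ext ⟨i, j⟩ ⟨i', j'⟩
    fin_cases i <;> fin_cases j <;> fin_cases i' <;> fin_cases j' <;>
      simp [pauliX, pauliZ, Matrix.one_apply, Matrix.mul_apply, Fintype.sum_prod_type] <;>
      first
        | linear_combination (1 / 4 : ℂ) * h'
        | ring
  · simp [pauliX, pauliZ, Matrix.trace, Fintype.sum_prod_type, Fin.sum_univ_two]
    norm_num

/-- **Primal feasibility, complementary case.** `B⁺` and `B⁻` are rank-2 orthogonal
projections, and `tr(B⁺ Π_x⁺) + tr(B⁻ Π_x⁻) = s_c(λ,t)`,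
`tr(B⁺ Π_z⁺) + tr(B⁻ Π_z⁻) = 0`, `tr(B⁺ Π_y⁺) + tr(B⁻ Π_y⁻) = 0`. -/
theorem complementary_primal_feasible (lam t : ℝ)
    (hlam : lam ∈ Set.Icc (0 : ℝ) 1) (ht : t ∈ Set.Icc (0 : ℝ) 1)
    (hne : (lam, t) ≠ (1, 0)) :
    ((BfeasP lam t)ᴴ = BfeasP lam t ∧ BfeasP lam t * BfeasP lam t = BfeasP lam t ∧
      (BfeasP lam t).trace = 2) ∧
    ((BfeasM lam t)ᴴ = BfeasM lam t ∧ BfeasM lam t * BfeasM lam t = BfeasM lam t ∧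
      (BfeasM lam t).trace = 2) ∧
    (BfeasP lam t * Pix lam t 1).trace + (BfeasM lam t * Pix lam t (-1)).trace
      = (sC lam t : ℂ) ∧
    (BfeasP lam t * Piz lam t 1).trace + (BfeasM lam t * Piz lam t (-1)).trace = 0 ∧
    (BfeasP lam t * Piy lam t 1).trace + (BfeasM lam t * Piy lam t (-1)).trace = 0 := by
  obtain ⟨hl0, hl1⟩ := hlam
  obtain ⟨ht0, ht1⟩ := ht
  have hbc := bc_sq lam t hl0 hl1 ht0
  refine ⟨proj_aux _ _ (by linarith) _ rfl, proj_aux _ _ hbc _ rfl, ?_, ?_, ?_⟩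
  · have h := congrArg (fun r : ℝ => (r : ℂ)) (real_identity lam t hl0 hl1 ht0 ht1)
    push_cast at h
    simp [BfeasP, BfeasM, Pix, Emat, pauliX, pauliZ, Matrix.one_apply, Matrix.trace,
      Matrix.mul_apply, Fintype.sum_prod_type, Fin.sum_univ_two, ← sub_eq_add_neg]
    linear_combination (1 / 4 : ℂ) * h
  · simp [BfeasP, BfeasM, Piz, pauliX, pauliZ, Matrix.one_apply, Matrix.trace,
      Matrix.mul_apply, Fintype.sum_prod_type, Fin.sum_univ_two]
    ring
  · simp [BfeasP, BfeasM, Piy, Fmat, pauliX, pauliZ, Matrix.one_apply, Matrix.trace,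
      Matrix.mul_apply, Fintype.sum_prod_type, Fin.sum_univ_two]
    ring
end
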